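/- There is no SCF (a probabilistic social choice function all of whose values are of the form Δ(X) for a nonempty subset X of the agenda) that satisfies both population-consistency and composition-consistency. -/

import Mathlib

open Finset

namespace PSC

/-- `r` is a linear order (complete, transitive, antisymmetric; as a set of pairs) on `A`. -/
def IsLinearOrderOn (A : Finset ℕ) (r : Finset (ℕ × ℕ)) : Prop :=
  r ⊆ A ×ˢ A ∧ (∀ x ∈ A, (x, x) ∈ r) ∧
    (∀ x ∈ A, ∀ y ∈ A, (x, y) ∈ r ∨ (y, x) ∈ r) ∧
    (∀ x y z : ℕ, (x, y) ∈ r → (y, z) ∈ r → (x, z) ∈ r) ∧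
    (∀ x y : ℕ, (x, y) ∈ r → (y, x) ∈ r → x = y)

open Classical in
/-- The set `L(A)` of linear orders on the agenda `A`. -/
noncomputable def linOrders (A : Finset ℕ) : Finset (Finset (ℕ × ℕ)) :=
  (A ×ˢ A).powerset.filter (fun r => IsLinearOrderOn A r)

/-- `R` is a (fractional) preference profile on the agenda `A`. -/
def IsProfile (A : Finset ℕ) (R : Finset (ℕ × ℕ) → ℚ) : Prop :=
  (∀ r, r ∉ linOrders A → R r = 0) ∧ (∀ r, 0 ≤ R r) ∧ (∑ r ∈ linOrders A, R r) = 1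

open Classical in
/-- `R(x,y)`: the total weight of orders ranking `x` strictly above `y`. -/
noncomputable def pref (A : Finset ℕ) (R : Finset (ℕ × ℕ) → ℚ) (x y : ℕ) : ℚ :=
  ∑ r ∈ (linOrders A).filter (fun r => (x, y) ∈ r ∧ (y, x) ∉ r), R r

/-- The majority margin `M_R(x,y) = R(x,y) - R(y,x)`. -/
noncomputable def margin (A : Finset ℕ) (R : Finset (ℕ × ℕ) → ℚ) (x y : ℕ) : ℚ :=
  pref A R x y - pref A R y x

/-- `p` is a lottery on `A`. -/
def IsLottery (A : Finset ℕ) (p : ℕ → ℚ) : Prop :=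
  (∀ x, x ∉ A → p x = 0) ∧ (∀ x, 0 ≤ p x) ∧ (∑ x ∈ A, p x) = 1

/-- `Δ(A)`, the set of lotteries on `A`. -/
def lotteries (A : Finset ℕ) : Set (ℕ → ℚ) := {p | IsLottery A p}

/-- 1-norm distance between two profiles on `A`. -/
noncomputable def profileDist (A : Finset ℕ) (R R' : Finset (ℕ × ℕ) → ℚ) : ℚ :=
  ∑ r ∈ linOrders A, |R r - R' r|

/-- 1-norm distance between two lotteries on `A`. -/
noncomputable def lotteryDist (A : Finset ℕ) (p q : ℕ → ℚ) : ℚ :=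
  ∑ x ∈ A, |p x - q x|

/-- Restriction of an order to `B`. -/
def restrictOrder (B : Finset ℕ) (r : Finset (ℕ × ℕ)) : Finset (ℕ × ℕ) := r ∩ B ×ˢ B

open Classical in
/-- The restriction `R|_B` of a profile on `A` to `B`. -/
noncomputable def restrictProfile (A B : Finset ℕ) (R : Finset (ℕ × ℕ) → ℚ) :
    Finset (ℕ × ℕ) → ℚ :=
  fun s => ∑ r ∈ (linOrders A).filter (fun r => restrictOrder B r = s), R r

/-- `B` is a component in the profile `R` on `A`. -/
def IsComponent (A B : Finset ℕ) (R : Finset (ℕ × ℕ) → ℚ) : Prop :=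
  B ⊆ A ∧ ∀ a ∈ A \ B, ∀ b ∈ B, ∀ b' ∈ B, ∀ r ∈ linOrders A, 0 < R r →
    ((a, b) ∈ r ↔ (a, b') ∈ r)

/-- The composed lottery `p ×_b q` (where `B` is the component). -/
def compLottery (B : Finset ℕ) (b : ℕ) (p q : ℕ → ℚ) : ℕ → ℚ :=
  fun x => if x ∈ B then p b * q x else p x

/-- `X ×_b Y` for sets of lotteries. -/
def compSet (B : Finset ℕ) (b : ℕ) (X Y : Set (ℕ → ℚ)) : Set (ℕ → ℚ) :=
  {pr | ∃ p ∈ X, ∃ q ∈ Y, pr = compLottery B b p q}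

/-- A probabilistic social choice function: to every (finite nonempty) agenda `A ⊆ ℕ` and
every profile on `A` it assigns a nonempty convex set of lotteries on `A`; it is upper
hemi-continuous and satisfies unanimity and decisiveness. -/
structure PSCF where
  choice : Finset ℕ → (Finset (ℕ × ℕ) → ℚ) → Set (ℕ → ℚ)
  nonempty : ∀ A : Finset ℕ, A.Nonempty → ∀ R, IsProfile A R → (choice A R).Nonempty
  subset_lotteries : ∀ A : Finset ℕ, A.Nonempty → ∀ R, IsProfile A R →
    choice A R ⊆ lotteries A
  convex : ∀ A : Finset ℕ, A.Nonempty → ∀ R, IsProfile A R →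
    ∀ p ∈ choice A R, ∀ q ∈ choice A R, ∀ t : ℚ, 0 ≤ t → t ≤ 1 →
      (fun x => t * p x + (1 - t) * q x) ∈ choice A R
  continuity : ∀ A : Finset ℕ, A.Nonempty → ∀ R, IsProfile A R → ∀ ε : ℚ, 0 < ε →
    ∃ δ : ℚ, 0 < δ ∧ ∀ R', IsProfile A R' → profileDist A R R' < δ →
      ∀ p ∈ choice A R', ∃ q ∈ choice A R, lotteryDist A p q < ε
  unanimity : ∀ x y : ℕ, ∀ R, IsProfile {x, y} R → pref {x, y} R x y = 1 →
    choice {x, y} R = {fun z => if z = x then 1 else 0}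
  decisive : ∀ A : Finset ℕ, A.Nonempty → ∀ R, IsProfile A R → ∀ ε : ℚ, 0 < ε →
    ∃ R', IsProfile A R' ∧ profileDist A R R' < ε ∧ ∃ p, choice A R' = {p}

/-- Population-consistency. -/
def PopulationConsistent (f : PSCF) : Prop :=
  ∀ A : Finset ℕ, A.Nonempty → ∀ R' R'', IsProfile A R' → IsProfile A R'' →
    ∀ l : ℚ, 0 ≤ l → l ≤ 1 →
      f.choice A R' ∩ f.choice A R'' ⊆ f.choice A (fun r => l * R' r + (1 - l) * R'' r)

/-- Composition-consistency. -/
def CompositionConsistent (f : PSCF) : Prop :=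
  ∀ A' B : Finset ℕ, ∀ b : ℕ, A' ∩ B = {b} →
    ∀ R, IsProfile (A' ∪ B) R → IsComponent (A' ∪ B) B R →
      f.choice (A' ∪ B) R =
        compSet B b (f.choice A' (restrictProfile (A' ∪ B) A' R))
          (f.choice B (restrictProfile (A' ∪ B) B R))

/-- The maximal-lotteries correspondence. -/
noncomputable def ML (A : Finset ℕ) (R : Finset (ℕ × ℕ) → ℚ) : Set (ℕ → ℚ) :=
  {p | IsLottery A p ∧ ∀ q, IsLottery A q →
    0 ≤ ∑ x ∈ A, ∑ y ∈ A, p x * margin A R x y * q y}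

/-- The uniform profile `uni(L(A))` on `A`. -/
noncomputable def uniProfile (A : Finset ℕ) : Finset (ℕ × ℕ) → ℚ :=
  fun r => if r ∈ linOrders A then ((Nat.factorial A.card : ℕ) : ℚ)⁻¹ else 0

/-- The uniform lottery `uni(A)` on `A`. -/
def uniLottery (A : Finset ℕ) : ℕ → ℚ :=
  fun x => if x ∈ A then (A.card : ℚ)⁻¹ else 0

/-- The degenerate lottery on `x`. -/
def degLottery (x : ℕ) : ℕ → ℚ := fun z => if z = x then 1 else 0

/-- `x` is a (weak) Condorcet winner in `R`. -/
def IsCondorcetWinner (A : Finset ℕ) (R : Finset (ℕ × ℕ) → ℚ) (x : ℕ) : Prop :=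
  x ∈ A ∧ ∀ y ∈ A, 0 ≤ margin A R x y

/-- `R` is regular on `A'`. -/
def Regular (A A' : Finset ℕ) (R : Finset (ℕ × ℕ) → ℚ) : Prop :=
  ∀ x ∈ A', (∑ y ∈ A', margin A R x y) = 0

/-- `R` is strongly regular on `A'`. -/
def StronglyRegular (A A' : Finset ℕ) (R : Finset (ℕ × ℕ) → ℚ) : Prop :=
  ∀ x ∈ A', ∀ y ∈ A', margin A R x y = 0

/-- Image of an order under a renaming `π`. -/
def mapOrder (π : ℕ → ℕ) (r : Finset (ℕ × ℕ)) : Finset (ℕ × ℕ) :=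
  r.image (fun xy => (π xy.1, π xy.2))

open Classical in
/-- The image `π(R)` of a profile on `A` under a renaming `π`. -/
noncomputable def mapProfile (π : ℕ → ℕ) (A : Finset ℕ) (R : Finset (ℕ × ℕ) → ℚ) :
    Finset (ℕ × ℕ) → ℚ :=
  fun s => ∑ r ∈ (linOrders A).filter (fun r => mapOrder π r = s), R r

open Classical in
/-- The image `π(p)` of a lottery on `A` under a renaming `π`. -/
noncomputable def mapLottery (π : ℕ → ℕ) (A : Finset ℕ) (p : ℕ → ℚ) : ℕ → ℚ :=
  fun y => ∑ x ∈ A.filter (fun x => π x = y), p x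

/-- The bound `ε_n = (4^n · ∏_{k=1}^n k!)⁻¹`. -/
noncomputable def epsN (n : ℕ) : ℚ :=
  (((4 ^ n * ∏ k ∈ Finset.Icc 1 n, Nat.factorial k : ℕ) : ℚ))⁻¹

/-- An SCF is a PSCF all of whose values are of the form `Δ(X)` for a nonempty `X ⊆ A`. -/
def IsSCF (f : PSCF) : Prop :=
  ∀ A : Finset ℕ, A.Nonempty → ∀ R, IsProfile A R →
    ∃ X : Finset ℕ, X ⊆ A ∧ X.Nonempty ∧ f.choice A R = lotteries X

/-- strict order a > b > c -/
def ord3 (a b c : ℕ) : Finset (ℕ × ℕ) := {(a,a),(b,b),(c,c),(a,b),(a,c),(b,c)}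

def ord2 (a b : ℕ) : Finset (ℕ × ℕ) := {(a,a),(b,b),(a,b)}

def half (r s : Finset (ℕ × ℕ)) : Finset (ℕ × ℕ) → ℚ :=
  fun t => (if t = r then 1/2 else 0) + (if t = s then 1/2 else 0)

lemma mem_linOrders {A : Finset ℕ} {r} : r ∈ linOrders A ↔ IsLinearOrderOn A r := by
  classical
  unfold linOrders
  rw [Finset.mem_filter, Finset.mem_powerset]
  exact ⟨fun h => h.2, fun h => ⟨h.1, h⟩⟩

lemma mem_ord3 {a b c u v : ℕ} : (u, v) ∈ ord3 a b c ↔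
    (u = a ∧ v = a) ∨ (u = b ∧ v = b) ∨ (u = c ∧ v = c) ∨ (u = a ∧ v = b) ∨ (u = a ∧ v = c) ∨
      (u = b ∧ v = c) := by
  simp [ord3]

lemma mem_ord2 {a b u v : ℕ} : (u, v) ∈ ord2 a b ↔
    (u = a ∧ v = a) ∨ (u = b ∧ v = b) ∨ (u = a ∧ v = b) := by
  simp [ord2]

lemma ord3_mem {A : Finset ℕ} {a b c : ℕ} (hab : a ≠ b) (hac : a ≠ c) (hbc : b ≠ c)
    (hA : ∀ x, x ∈ A ↔ x = a ∨ x = b ∨ x = c) : ord3 a b c ∈ linOrders A := by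
  rw [mem_linOrders]
  refine ⟨?_, ?_, ?_, ?_, ?_⟩
  · rintro ⟨u, v⟩ h
    rw [mem_ord3] at h
    rw [Finset.mem_product, hA, hA]
    grind
  · intro x hx
    rw [hA] at hx
    rw [mem_ord3]; grind
  · intro x hx y hy
    rw [hA] at hx hy
    rw [mem_ord3, mem_ord3]; grind
  · intro x y z
    rw [mem_ord3, mem_ord3, mem_ord3]; grind
  · intro x y
    rw [mem_ord3, mem_ord3]; grind

lemma ord2_mem {A : Finset ℕ} {a b : ℕ} (hab : a ≠ b)
    (hA : ∀ x, x ∈ A ↔ x = a ∨ x = b) : ord2 a b ∈ linOrders A := by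
  rw [mem_linOrders]
  refine ⟨?_, ?_, ?_, ?_, ?_⟩
  · rintro ⟨u, v⟩ h
    rw [mem_ord2] at h
    rw [Finset.mem_product, hA, hA]
    grind
  · intro x hx
    rw [hA] at hx
    rw [mem_ord2]; grind
  · intro x hx y hy
    rw [hA] at hx hy
    rw [mem_ord2, mem_ord2]; grind
  · intro x y z
    rw [mem_ord2, mem_ord2, mem_ord2]; grind
  · intro x y
    rw [mem_ord2, mem_ord2]; grind

lemma ord3_cases {a b c : ℕ} {r} (hr : r ∈ linOrders {a, b, c}) :
    r = ord3 a b c ∨ r = ord3 a c b ∨ r = ord3 b a c ∨ r = ord3 b c a ∨ r = ord3 c a b ∨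
      r = ord3 c b a := by
  rw [mem_linOrders] at hr
  obtain ⟨h1, h2, h3, h4, h5⟩ := hr
  have hs : ∀ u v, (u, v) ∈ r → (u = a ∨ u = b ∨ u = c) ∧ (v = a ∨ v = b ∨ v = c) := by
    intro u v h
    have := h1 h
    simpa using this
  have haa := h2 a (by simp)
  have hbb := h2 b (by simp)
  have hcc := h2 c (by simp)
  have key : ∀ x y z : ℕ, (∀ u v, (u, v) ∈ r → (u = x ∨ u = y ∨ u = z) ∧ (v = x ∨ v = y ∨ v = z)) →
      (x,x) ∈ r → (y,y) ∈ r → (z,z) ∈ r → (x,y) ∈ r → (y,z) ∈ r → r = ord3 x y z := by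
    intro x y z hs hx hy hz hxy hyz
    have hxz := h4 _ _ _ hxy hyz
    ext ⟨u, v⟩
    rw [mem_ord3]
    constructor
    · intro h
      obtain ⟨hu, hv⟩ := hs u v h
      have := h5 u v h
      rcases hu with rfl | rfl | rfl <;> rcases hv with rfl | rfl | rfl <;> grind
    · rintro (⟨rfl, rfl⟩ | ⟨rfl, rfl⟩ | ⟨rfl, rfl⟩ | ⟨rfl, rfl⟩ | ⟨rfl, rfl⟩ | ⟨rfl, rfl⟩) <;>
        assumption
  rcases h3 a (by simp) b (by simp) with hab | hab <;>
  rcases h3 a (by simp) c (by simp) with hac | hac <;>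
  rcases h3 b (by simp) c (by simp) with hbc | hbc
  · left; exact key _ _ _ (by grind) haa hbb hcc hab hbc
  · right; left; exact key _ _ _ (by grind) haa hcc hbb hac hbc
  · left; exact key _ _ _ (by grind) haa hbb hcc hab hbc
  · right; right; right; right; left; exact key _ _ _ (by grind) hcc haa hbb hac hab
  · right; right; left; exact key _ _ _ (by grind) hbb haa hcc hab hac
  · right; left; exact key _ _ _ (by grind) haa hcc hbb hac hbc
  · right; right; right; left; exact key _ _ _ (by grind) hbb hcc haa hbc hac
  · right; right; right; right; right; exact key _ _ _ (by grind) hcc hbb haa hbc hab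

lemma sum_half {L : Finset (Finset (ℕ × ℕ))} {r s} (hr : r ∈ L) (hs : s ∈ L) :
    ∑ t ∈ L, half r s t = 1 := by
  unfold half
  rw [Finset.sum_add_distrib, Finset.sum_ite_eq', Finset.sum_ite_eq', if_pos hr, if_pos hs]
  norm_num

lemma half_profile {A : Finset ℕ} {r s} (hr : r ∈ linOrders A) (hs : s ∈ linOrders A) :
    IsProfile A (half r s) := by
  refine ⟨?_, ?_, sum_half hr hs⟩
  · intro t ht
    have h1 : t ≠ r := by rintro rfl; exact ht hr
    have h2 : t ≠ s := by rintro rfl; exact ht hs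
    simp [half, h1, h2]
  · intro t
    unfold half
    split_ifs <;> norm_num

lemma half_comm (r s) : half r s = half s r := by
  funext t; unfold half; ring

lemma restrict_half {A B : Finset ℕ} {r s} (hr : r ∈ linOrders A) (hs : s ∈ linOrders A) :
    restrictProfile A B (half r s) = half (restrictOrder B r) (restrictOrder B s) := by
  funext t
  unfold restrictProfile half
  rw [Finset.sum_add_distrib, Finset.sum_ite_eq', Finset.sum_ite_eq']
  simp only [Finset.mem_filter, hr, hs, true_and]
  congr 1 <;> simp only [eq_comm]

lemma restrict_ord3 {B : Finset ℕ} {a b c x y : ℕ} (hB : ∀ u, u ∈ B ↔ u = x ∨ u = y)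
    (h : (a ≠ b ∧ a ≠ c ∧ b ≠ c) ∧
      ((x = a ∧ y = b) ∨ (x = a ∧ y = c) ∨ (x = b ∧ y = c))) :
    restrictOrder B (ord3 a b c) = ord2 x y := by
  ext ⟨u, v⟩
  unfold restrictOrder
  rw [Finset.mem_inter, Finset.mem_product, mem_ord3, mem_ord2, hB, hB]
  grind

lemma deg_lottery {A : Finset ℕ} {x : ℕ} (hx : x ∈ A) : IsLottery A (degLottery x) := by
  refine ⟨?_, ?_, ?_⟩
  · intro y hy
    have : y ≠ x := by rintro rfl; exact hy hx
    simp [degLottery, this]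
  · intro y; unfold degLottery; split_ifs <;> norm_num
  · unfold degLottery; rw [Finset.sum_ite_eq', if_pos hx]

lemma eq_deg {A : Finset ℕ} {p} {x : ℕ} (hx : x ∈ A) (hp : IsLottery A p) (h1 : p x = 1) :
    p = degLottery x := by
  obtain ⟨h2, h3, h4⟩ := hp
  have h5 : ∑ y ∈ A.erase x, p y = 0 := by
    have := Finset.add_sum_erase A p hx
    linarith
  rw [Finset.sum_eq_zero_iff_of_nonneg (fun i _ => h3 i)] at h5
  funext y
  unfold degLottery
  split_ifs with h
  · rw [h, h1]
  · by_cases hy : y ∈ A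
    · exact h5 y (Finset.mem_erase.2 ⟨h, hy⟩)
    · exact h2 y hy

lemma una (f : PSCF) {x y : ℕ} (hxy : x ≠ y) :
    f.choice {x, y} (half (ord2 x y) (ord2 x y)) = {degLottery x} := by
  have hm : ord2 x y ∈ linOrders {x, y} := ord2_mem hxy (by simp)
  refine f.unanimity x y _ (half_profile hm hm) ?_
  unfold pref
  apply sum_half <;>
  · rw [Finset.mem_filter, mem_ord2, mem_ord2]
    refine ⟨hm, by simp, ?_⟩
    grind

/-- A workable form of composition-consistency: outside `a`, component `{b,c}`. -/
lemma comp (f : PSCF) (hf : CompositionConsistent f) {A A' B : Finset ℕ} {b : ℕ} {r s}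
    (hA : A' ∪ B = A) (hI : A' ∩ B = {b})
    (hr : r ∈ linOrders A) (hs : s ∈ linOrders A)
    (hcr : ∀ a ∈ A \ B, ∀ b ∈ B, ∀ b' ∈ B, (a, b) ∈ r ↔ (a, b') ∈ r)
    (hcs : ∀ a ∈ A \ B, ∀ b ∈ B, ∀ b' ∈ B, (a, b) ∈ s ↔ (a, b') ∈ s) :
    f.choice A (half r s) = compSet B b
      (f.choice A' (half (restrictOrder A' r) (restrictOrder A' s)))
      (f.choice B (half (restrictOrder B r) (restrictOrder B s))) := by
  subst hA
  rw [← restrict_half hr hs, ← restrict_half hr hs]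
  refine hf A' B b hI _ (half_profile hr hs) ⟨Finset.subset_union_right, ?_⟩
  intro a ha b hb b' hb' t _ ht
  by_cases h1 : t = r
  · rw [h1]; exact hcr a ha b hb b' hb'
  by_cases h2 : t = s
  · rw [h2]; exact hcs a ha b hb b' hb'
  simp [half, h1, h2] at ht

/-- specialised: `a` outside, component `{b,c}`, `x y` are the restrictions. -/
lemma comp3 (f : PSCF) (hf : CompositionConsistent f) {a b c : ℕ} {r s}
    (hab : a ≠ b) (hac : a ≠ c) (hbc : b ≠ c)
    (hr : r = ord3 a b c ∨ r = ord3 a c b ∨ r = ord3 b c a ∨ r = ord3 c b a)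
    (hs : s = ord3 a b c ∨ s = ord3 a c b ∨ s = ord3 b c a ∨ s = ord3 c b a) :
    f.choice {a, b, c} (half r s) = compSet {b, c} b
      (f.choice {a, b} (half (restrictOrder {a, b} r) (restrictOrder {a, b} s)))
      (f.choice {b, c} (half (restrictOrder {b, c} r) (restrictOrder {b, c} s))) := by
  have hm : ∀ r, (r = ord3 a b c ∨ r = ord3 a c b ∨ r = ord3 b c a ∨ r = ord3 c b a) →
      r ∈ linOrders {a, b, c} := by
    rintro r (rfl | rfl | rfl | rfl) <;> apply ord3_mem <;> grind
  have hc : ∀ r, (r = ord3 a b c ∨ r = ord3 a c b ∨ r = ord3 b c a ∨ r = ord3 c b a) →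
      ∀ x ∈ ({a, b, c} : Finset ℕ) \ {b, c}, ∀ y ∈ ({b, c} : Finset ℕ), ∀ y' ∈ ({b, c} : Finset ℕ),
        (x, y) ∈ r ↔ (x, y') ∈ r := by
    intro r hr x hx y hy y' hy'
    have hx' : x = a := by grind
    subst hx'
    rw [Finset.mem_insert, Finset.mem_singleton] at hy hy'
    rcases hr with rfl | rfl | rfl | rfl <;> rw [mem_ord3, mem_ord3] <;> grind
  refine comp f hf ?_ ?_ (hm r hr) (hm s hs) (hc r hr) (hc s hs)
  · ext x; simp only [Finset.mem_union, Finset.mem_insert, Finset.mem_singleton]; grind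
  · ext x; simp only [Finset.mem_inter, Finset.mem_insert, Finset.mem_singleton]; grind

lemma compSet_deg_out {B : Finset ℕ} {a b : ℕ} {X Y : Set (ℕ → ℚ)} (ha : a ∉ B) (hb : b ∈ B)
    (hX : degLottery a ∈ X) (hY : Y.Nonempty) : degLottery a ∈ compSet B b X Y := by
  obtain ⟨q, hq⟩ := hY
  refine ⟨_, hX, q, hq, ?_⟩
  funext x
  unfold compLottery degLottery
  grind

lemma compSet_deg_in {B : Finset ℕ} {b d : ℕ} {X Y : Set (ℕ → ℚ)} (hd : d ∈ B)
    (hX : degLottery b ∈ X) (hb : b ∈ B) (hY : degLottery d ∈ Y) :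
    degLottery d ∈ compSet B b X Y := by
  refine ⟨_, hX, _, hY, ?_⟩
  funext x
  unfold compLottery degLottery
  grind

def Tie (f : PSCF) (x y : ℕ) : Prop :=
  degLottery x ∈ f.choice {x, y} (half (ord2 x y) (ord2 y x))

lemma tie_profile {x y : ℕ} (h : x ≠ y) : IsProfile {x, y} (half (ord2 x y) (ord2 y x)) :=
  half_profile (ord2_mem h (by simp)) (ord2_mem h.symm (by grind))

lemma tie_right (f : PSCF) (hf : CompositionConsistent f) {x y z : ℕ}
    (hxy : x ≠ y) (hxz : x ≠ z) (hyz : y ≠ z) (h : Tie f x y) : Tie f x z := by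
  have e1 := comp3 f hf hxy hxz hyz (r := ord3 x y z) (s := ord3 y z x) (by simp) (by simp)
  have e2 := comp3 f hf hxz hxy hyz.symm (r := ord3 x y z) (s := ord3 y z x) (by simp) (by simp)
  rw [restrict_ord3 (x := x) (y := y) (by simp) (by grind),
    restrict_ord3 (x := y) (y := x) (by grind) (by grind),
    restrict_ord3 (x := y) (y := z) (by simp) (by grind),
    restrict_ord3 (x := y) (y := z) (by simp) (by grind)] at e1
  rw [restrict_ord3 (x := x) (y := z) (by simp) (by grind),
    restrict_ord3 (x := z) (y := x) (by grind) (by grind),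
    restrict_ord3 (x := y) (y := z) (by grind) (by grind),
    restrict_ord3 (x := y) (y := z) (by grind) (by grind)] at e2
  rw [show ({x, z, y} : Finset ℕ) = {x, y, z} by grind, e1] at e2
  have hd : degLottery x ∈ compSet {y, z} y
      (f.choice {x, y} (half (ord2 x y) (ord2 y x)))
      (f.choice {y, z} (half (ord2 y z) (ord2 y z))) :=
    compSet_deg_out (by grind) (by simp) h (by rw [una f hyz]; exact ⟨_, rfl⟩)
  rw [e2] at hd
  obtain ⟨p, hp, q, hq, he⟩ := hd
  have := congrFun he x
  have hxB : x ∉ ({z, y} : Finset ℕ) := by grind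
  simp only [compLottery, hxB, if_false, degLottery, if_true] at this
  have hl := f.subset_lotteries {x, z} (by simp) _ (tie_profile hxz) hp
  have := eq_deg (by simp) hl this.symm
  rw [this] at hp
  exact hp

lemma tie_left (f : PSCF) (hf : CompositionConsistent f) {x y z : ℕ}
    (hxy : x ≠ y) (hxz : x ≠ z) (hyz : y ≠ z) (h : Tie f x y) : Tie f z y := by
  have e1 := comp3 f hf hxy.symm hyz hxz (r := ord3 x z y) (s := ord3 y x z) (by simp) (by simp)
  have e2 := comp3 f hf hyz hxy.symm hxz.symm (r := ord3 x z y) (s := ord3 y x z)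
    (by simp) (by simp)
  rw [restrict_ord3 (x := x) (y := y) (by grind) (by grind),
    restrict_ord3 (x := y) (y := x) (by grind) (by grind),
    restrict_ord3 (x := x) (y := z) (by grind) (by grind),
    restrict_ord3 (x := x) (y := z) (by grind) (by grind)] at e1
  rw [restrict_ord3 (x := z) (y := y) (by grind) (by grind),
    restrict_ord3 (x := y) (y := z) (by grind) (by grind),
    restrict_ord3 (x := x) (y := z) (by grind) (by grind),
    restrict_ord3 (x := x) (y := z) (by grind) (by grind)] at e2
  rw [show ({y, z, x} : Finset ℕ) = {y, x, z} by grind, e1] at e2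
  have hd : degLottery x ∈ compSet {x, z} x
      (f.choice {y, x} (half (ord2 x y) (ord2 y x)))
      (f.choice {x, z} (half (ord2 x z) (ord2 x z))) := by
    refine compSet_deg_in (by simp) ?_ (by simp) (by rw [una f hxz]; rfl)
    rw [Finset.pair_comm]; exact h
  rw [e2, Finset.pair_comm z x, una f hxz] at hd
  obtain ⟨p, hp, q, hq, he⟩ := hd
  have hq' : q = degLottery x := hq
  subst hq'
  have := congrFun he x
  have hxB : x ∈ ({x, z} : Finset ℕ) := by simp
  simp only [compLottery, hxB, degLottery, if_true, mul_one] at this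
  rw [Finset.pair_comm] at hp
  have hl := f.subset_lotteries {z, y} (by simp) _ (tie_profile hyz.symm) hp
  have := eq_deg (by simp) hl this.symm
  rw [this] at hp
  exact hp

lemma exists_deg (f : PSCF) (hS : IsSCF f) {A : Finset ℕ} {R} (hA : A.Nonempty)
    (hR : IsProfile A R) : ∃ x ∈ A, degLottery x ∈ f.choice A R := by
  obtain ⟨X, hX, ⟨x, hx⟩, h⟩ := hS A hA R hR
  exact ⟨x, hX hx, by rw [h]; exact deg_lottery hx⟩

lemma tie_swap (f : PSCF) (hf : CompositionConsistent f) {x y : ℕ} (hxy : x ≠ y)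
    (h : Tie f x y) : Tie f y x := by
  obtain ⟨z, hz⟩ := Finset.exists_notMem ({x, y} : Finset ℕ)
  have hzx : z ≠ x := by grind
  have hzy : z ≠ y := by grind
  have h1 := tie_left f hf hxy hzx.symm hzy.symm h
  have h2 := tie_right f hf hzy hzx hxy.symm h1
  exact tie_left f hf hzx hzy hxy h2

lemma tie (f : PSCF) (hS : IsSCF f) (hf : CompositionConsistent f) {x y : ℕ} (hxy : x ≠ y) :
    Tie f x y := by
  obtain ⟨z, hz, h⟩ := exists_deg f hS (by simp) (tie_profile hxy)
  rw [Finset.mem_insert, Finset.mem_singleton] at hz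
  rcases hz with rfl | rfl
  · exact h
  · apply tie_swap f hf hxy.symm
    unfold Tie
    rw [Finset.pair_comm, half_comm]
    exact h

/-- On pairs. -/
lemma pairTop (f : PSCF) (hS : IsSCF f) (hf : CompositionConsistent f) {x y : ℕ} {B : Finset ℕ}
    {r s} (hxy : x ≠ y) (hB : B = {x, y}) (h : (r = ord2 x y ∧ s = ord2 x y) ∨
      (r = ord2 x y ∧ s = ord2 y x) ∨ (r = ord2 y x ∧ s = ord2 x y)) :
    degLottery x ∈ f.choice B (half r s) := by
  subst hB
  rcases h with ⟨rfl, rfl⟩ | ⟨rfl, rfl⟩ | ⟨rfl, rfl⟩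
  · rw [una f hxy]; rfl
  · exact tie f hS hf hxy
  · rw [half_comm]; exact tie f hS hf hxy

/-- `a` outside and at least tied. -/
lemma caseOut (f : PSCF) (hS : IsSCF f) (hf : CompositionConsistent f) {a b c : ℕ} {r s}
    (hab : a ≠ b) (hac : a ≠ c) (hbc : b ≠ c)
    (hr : r = ord3 a b c)
    (hs : s = ord3 a b c ∨ s = ord3 a c b ∨ s = ord3 b c a ∨ s = ord3 c b a) :
    degLottery a ∈ f.choice {a, b, c} (half r s) := by
  rw [comp3 f hf hab hac hbc (Or.inl hr) hs]
  have hn : (f.choice {b, c} (half (restrictOrder {b, c} r) (restrictOrder {b, c} s))).Nonempty := by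
    apply f.nonempty _ (by simp)
    subst hr
    rw [restrict_ord3 (x := b) (y := c) (by simp) (by grind)]
    refine half_profile (ord2_mem hbc (by simp)) ?_
    rcases hs with rfl | rfl | rfl | rfl
    · rw [restrict_ord3 (x := b) (y := c) (by simp) (by grind)]; exact ord2_mem hbc (by simp)
    · rw [restrict_ord3 (x := c) (y := b) (by grind) (by grind)]; exact ord2_mem hbc.symm (by grind)
    · rw [restrict_ord3 (x := b) (y := c) (by simp) (by grind)]; exact ord2_mem hbc (by simp)
    · rw [restrict_ord3 (x := c) (y := b) (by grind) (by grind)]; exact ord2_mem hbc.symm (by grind)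
  refine compSet_deg_out (by grind) (by simp) ?_ hn
  apply pairTop f hS hf hab rfl
  subst hr
  rw [restrict_ord3 (x := a) (y := b) (by simp) (by grind)]
  rcases hs with rfl | rfl | rfl | rfl
  · rw [restrict_ord3 (x := a) (y := b) (by simp) (by grind)]; simp
  · rw [restrict_ord3 (x := a) (y := b) (by grind) (by grind)]; simp
  · rw [restrict_ord3 (x := b) (y := a) (by grind) (by grind)]; simp
  · rw [restrict_ord3 (x := b) (y := a) (by grind) (by grind)]; simp

/-- `b` inside the component `{b,c}`. -/
lemma caseIn (f : PSCF) (hS : IsSCF f) (hf : CompositionConsistent f) {a b c : ℕ} {r s}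
    (hab : a ≠ b) (hac : a ≠ c) (hbc : b ≠ c)
    (h : (r = ord3 b c a ∧ s = ord3 a b c) ∨ (r = ord3 b c a ∧ s = ord3 c b a) ∨
      (r = ord3 b c a ∧ s = ord3 a c b) ∨ (r = ord3 c b a ∧ s = ord3 a b c)) :
    degLottery b ∈ f.choice {a, b, c} (half r s) := by
  rw [comp3 f hf hab hac hbc (by grind) (by grind)]
  refine compSet_deg_in (by simp) ?_ (by simp) ?_
  · apply pairTop f hS hf hab.symm (Finset.pair_comm _ _)
    rcases h with ⟨rfl, rfl⟩ | ⟨rfl, rfl⟩ | ⟨rfl, rfl⟩ | ⟨rfl, rfl⟩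
    · rw [restrict_ord3 (x := b) (y := a) (by grind) (by grind),
        restrict_ord3 (x := a) (y := b) (by grind) (by grind)]; simp
    · rw [restrict_ord3 (x := b) (y := a) (by grind) (by grind),
        restrict_ord3 (x := b) (y := a) (by grind) (by grind)]; simp
    · rw [restrict_ord3 (x := b) (y := a) (by grind) (by grind),
        restrict_ord3 (x := a) (y := b) (by grind) (by grind)]; simp
    · rw [restrict_ord3 (x := b) (y := a) (by grind) (by grind),
        restrict_ord3 (x := a) (y := b) (by grind) (by grind)]; simp
  · apply pairTop f hS hf hbc rfl
    rcases h with ⟨rfl, rfl⟩ | ⟨rfl, rfl⟩ | ⟨rfl, rfl⟩ | ⟨rfl, rfl⟩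
    · rw [restrict_ord3 (x := b) (y := c) (by grind) (by grind),
        restrict_ord3 (x := b) (y := c) (by grind) (by grind)]; simp
    · rw [restrict_ord3 (x := b) (y := c) (by grind) (by grind),
        restrict_ord3 (x := c) (y := b) (by grind) (by grind)]; simp
    · rw [restrict_ord3 (x := b) (y := c) (by grind) (by grind),
        restrict_ord3 (x := c) (y := b) (by grind) (by grind)]; simp
    · rw [restrict_ord3 (x := c) (y := b) (by grind) (by grind),
        restrict_ord3 (x := b) (y := c) (by grind) (by grind)]; simp

lemma topPair (f : PSCF) (hS : IsSCF f) (hf : CompositionConsistent f) {a b c : ℕ} {s}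
    (hab : a ≠ b) (hac : a ≠ c) (hbc : b ≠ c) (hs : s ∈ linOrders {a, b, c}) :
    degLottery a ∈ f.choice {a, b, c} (half (ord3 a b c) s) := by
  rcases ord3_cases hs with h | h | h | h | h | h
  · exact caseOut f hS hf hab hac hbc rfl (by simp [h])
  · exact caseOut f hS hf hab hac hbc rfl (by simp [h])
  · rw [show ({a, b, c} : Finset ℕ) = {c, a, b} by grind]
    exact caseIn f hS hf hac.symm hbc.symm hab (by simp [h])
  · exact caseOut f hS hf hab hac hbc rfl (by simp [h])
  · rw [show ({a, b, c} : Finset ℕ) = {c, a, b} by grind]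
    exact caseIn f hS hf hac.symm hbc.symm hab (by simp [h])
  · exact caseOut f hS hf hab hac hbc rfl (by simp [h])

def KSet (f : PSCF) (A : Finset ℕ) (x : ℕ) : Set (Finset (ℕ × ℕ) → ℚ) :=
  {R | IsProfile A R ∧ degLottery x ∈ f.choice A R}

lemma mix_profile {A : Finset ℕ} {R S} (hR : IsProfile A R) (hS : IsProfile A S) {l : ℚ}
    (h0 : 0 ≤ l) (h1 : l ≤ 1) : IsProfile A (fun r => l * R r + (1 - l) * S r) := by
  refine ⟨fun r hr => ?_, fun r => ?_, ?_⟩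
  · simp [hR.1 r hr, hS.1 r hr]
  · have := hR.2.1 r
    have := hS.2.1 r
    have : 0 ≤ 1 - l := by linarith
    positivity
  · rw [Finset.sum_add_distrib, ← Finset.mul_sum, ← Finset.mul_sum, hR.2.2, hS.2.2]; ring

lemma KSet_mix (f : PSCF) (hP : PopulationConsistent f) {A : Finset ℕ} (hA : A.Nonempty) {x : ℕ}
    {R S} (hR : R ∈ KSet f A x) (hS : S ∈ KSet f A x) {l : ℚ} (h0 : 0 ≤ l) (h1 : l ≤ 1) :
    (fun r => l * R r + (1 - l) * S r) ∈ KSet f A x :=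
  ⟨mix_profile hR.1 hS.1 h0 h1, hP A hA R S hR.1 hS.1 l h0 h1 ⟨hR.2, hS.2⟩⟩

lemma KSet_convex (f : PSCF) (hP : PopulationConsistent f) {A : Finset ℕ} (hA : A.Nonempty)
    {x : ℕ} : Convex ℚ (KSet f A x) := by
  intro R hR S hS u v hu hv huv
  have := KSet_mix f hP hA hR hS hu (by linarith)
  have e : v = 1 - u := by linarith
  subst e
  exact this

lemma topHalf (f : PSCF) (hS : IsSCF f) (hP : PopulationConsistent f)
    (hf : CompositionConsistent f) {a b c : ℕ}
    (hab : a ≠ b) (hac : a ≠ c) (hbc : b ≠ c) {S} (hSp : IsProfile {a, b, c} S)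
    (h : 1/2 ≤ S (ord3 a b c)) : S ∈ KSet f {a, b, c} a := by
  set r0 := ord3 a b c with hr0
  have hm : r0 ∈ linOrders {a, b, c} := ord3_mem hab hac hbc (by simp)
  have hsum : ∑ r ∈ linOrders {a, b, c}, (2 * S r - if r = r0 then 1 else 0) = 1 := by
    rw [Finset.sum_sub_distrib, ← Finset.mul_sum, hSp.2.2, Finset.sum_ite_eq', if_pos hm]
    norm_num
  have key := (KSet_convex f hP (A := {a, b, c}) (by simp) (x := a)).sum_mem
    (t := linOrders {a, b, c}) (w := fun r => 2 * S r - if r = r0 then 1 else 0)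
    (z := fun r => half r0 r) ?_ hsum ?_
  · convert key using 1
    funext t
    rw [Finset.sum_apply]
    simp only [Pi.smul_apply, smul_eq_mul]
    unfold half
    simp only [mul_add, Finset.sum_add_distrib]
    rw [← Finset.sum_mul, hsum]
    simp only [mul_ite, mul_zero]
    rw [Finset.sum_ite_eq]
    by_cases ht : t ∈ linOrders {a, b, c}
    · rw [if_pos ht]; split_ifs <;> ring
    · have : t ≠ r0 := by rintro rfl; exact ht hm
      rw [if_neg ht, if_neg this, hSp.1 t ht]; ring
  · intro r _
    have := hSp.2.1 r
    split_ifs with h'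
    · rw [h']; linarith
    · linarith
  · intro r hr
    exact ⟨half_profile hm hr, topPair f hS hf hab hac hbc hr⟩

def cyc (a b c : ℕ) : Finset (ℕ × ℕ) → ℚ := fun t =>
  (if t = ord3 a b c then 1/3 else 0) + (if t = ord3 b c a then 1/3 else 0) +
    (if t = ord3 c a b then 1/3 else 0)

lemma cyc_rot (a b c : ℕ) : cyc a b c = cyc b c a := by
  funext t; unfold cyc; ring

lemma mem_all {a b c : ℕ} (hab : a ≠ b) (hac : a ≠ c) (hbc : b ≠ c) :
    ord3 a b c ∈ linOrders {a, b, c} ∧ ord3 a c b ∈ linOrders {a, b, c} ∧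
    ord3 b c a ∈ linOrders {a, b, c} ∧ ord3 c a b ∈ linOrders {a, b, c} := by
  refine ⟨?_, ?_, ?_, ?_⟩ <;> apply ord3_mem <;> grind

lemma cyc_profile {a b c : ℕ} (hab : a ≠ b) (hac : a ≠ c) (hbc : b ≠ c) :
    IsProfile {a, b, c} (cyc a b c) := by
  obtain ⟨m1, m2, m3, m4⟩ := mem_all hab hac hbc
  refine ⟨?_, ?_, ?_⟩
  · intro t ht
    unfold cyc
    rw [if_neg, if_neg, if_neg]
    · norm_num
    all_goals rintro rfl; contradiction
  · intro t; unfold cyc; split_ifs <;> norm_num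
  · unfold cyc
    rw [Finset.sum_add_distrib, Finset.sum_add_distrib, Finset.sum_ite_eq', Finset.sum_ite_eq',
      Finset.sum_ite_eq', if_pos m1, if_pos m3, if_pos m4]
    norm_num

def QQ (a b c : ℕ) : Finset (ℕ × ℕ) → ℚ := fun t =>
  (if t = ord3 a b c then 11/60 else 0) + (if t = ord3 b c a then 11/60 else 0) +
    (if t = ord3 c a b then 11/30 else 0) + (if t = ord3 a c b then 4/15 else 0)

lemma QQ_profile {a b c : ℕ} (hab : a ≠ b) (hac : a ≠ c) (hbc : b ≠ c) :
    IsProfile {a, b, c} (QQ a b c) := by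
  obtain ⟨m1, m2, m3, m4⟩ := mem_all hab hac hbc
  refine ⟨?_, ?_, ?_⟩
  · intro t ht
    unfold QQ
    rw [if_neg, if_neg, if_neg, if_neg]
    · norm_num
    all_goals rintro rfl; contradiction
  · intro t; unfold QQ; split_ifs <;> norm_num
  · unfold QQ
    rw [Finset.sum_add_distrib, Finset.sum_add_distrib, Finset.sum_add_distrib,
      Finset.sum_ite_eq', Finset.sum_ite_eq', Finset.sum_ite_eq', Finset.sum_ite_eq',
      if_pos m1, if_pos m3, if_pos m4, if_pos m2]
    norm_num

lemma ord3_inj {a b c x y z : ℕ} (hab : a ≠ b) (hac : a ≠ c) (hbc : b ≠ c)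
    (h : (b, a) ∈ ord3 x y z ∨ (c, a) ∈ ord3 x y z ∨ (c, b) ∈ ord3 x y z) :
    ord3 a b c ≠ ord3 x y z := by
  intro e
  rw [← e, mem_ord3, mem_ord3, mem_ord3] at h
  grind

lemma main (f : PSCF) (hS : IsSCF f) (hP : PopulationConsistent f)
    (hf : CompositionConsistent f) {a b c : ℕ}
    (hab : a ≠ b) (hac : a ≠ c) (hbc : b ≠ c)
    (h : degLottery a ∈ f.choice {a, b, c} (cyc a b c)) : False := by
  obtain ⟨m1, m2, m3, m4⟩ := mem_all hab hac hbc
  have n12 : ord3 a b c ≠ ord3 a c b := ord3_inj hab hac hbc (by simp [ord3])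
  have n13 : ord3 a b c ≠ ord3 b c a := ord3_inj hab hac hbc (by simp [ord3])
  have n14 : ord3 a b c ≠ ord3 c a b := ord3_inj hab hac hbc (by simp [ord3])
  have n23 : ord3 a c b ≠ ord3 b c a := ord3_inj hac hab hbc.symm (by simp [ord3])
  have n24 : ord3 a c b ≠ ord3 c a b := ord3_inj hac hab hbc.symm (by simp [ord3])
  have n34 : ord3 b c a ≠ ord3 c a b := ord3_inj hbc hab.symm hac.symm (by simp [ord3])
  obtain ⟨R, hR, hd, p, hp⟩ := f.decisive {a, b, c} (by simp) (QQ a b c)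
    (QQ_profile hab hac hbc) (1/60) (by norm_num)
  have near : ∀ r ∈ linOrders {a, b, c}, |QQ a b c r - R r| < 1/60 := by
    intro r hr
    refine lt_of_le_of_lt ?_ hd
    unfold profileDist
    exact Finset.single_le_sum (f := fun r => |QQ a b c r - R r|) (fun i _ => abs_nonneg _) hr
  have w1 := abs_lt.1 (near _ m1)
  have w2 := abs_lt.1 (near _ m2)
  have w3 := abs_lt.1 (near _ m3)
  have w4 := abs_lt.1 (near _ m4)
  simp only [QQ, n12, n13, n14, n23, n24, n34, n12.symm, n13.symm, n14.symm, n23.symm, n24.symm,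
    n34.symm, if_true, if_false] at w1 w2 w3 w4
  -- `a` is chosen
  have ha : R ∈ KSet f {a, b, c} a := by
    have hT : IsProfile {a, c, b} (fun r => 2 * R r - cyc a b c r) := by
      rw [show ({a, c, b} : Finset ℕ) = {a, b, c} by grind]
      have hc := cyc_profile hab hac hbc
      refine ⟨fun r hr => ?_, fun r => ?_, ?_⟩
      · dsimp only
        rw [hR.1 r hr, hc.1 r hr]; norm_num
      · have := hR.2.1 r
        unfold cyc
        by_cases e1 : r = ord3 a b c
        · subst e1; simp only [n12, n13, n14, if_true, if_false]; linarith
        by_cases e3 : r = ord3 b c a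
        · subst e3; simp only [n13.symm, n34, if_true, if_false]; linarith
        by_cases e4 : r = ord3 c a b
        · subst e4; simp only [n14.symm, n34.symm, if_true, if_false]; linarith
        simp only [e1, e3, e4, if_false]; linarith
      · rw [Finset.sum_sub_distrib, ← Finset.mul_sum, hR.2.2, hc.2.2]; norm_num
    have := topHalf f hS hP hf hac hab hbc.symm hT (by
      simp only [cyc, n12.symm, n23, n24, if_false]; linarith)
    rw [show ({a, c, b} : Finset ℕ) = {a, b, c} by grind] at this
    have := KSet_mix f hP (by simp) this ⟨cyc_profile hab hac hbc, h⟩ (l := 1/2)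
      (by norm_num) (by norm_num)
    convert this using 1
    funext r; ring
  have hc : R ∈ KSet f {a, b, c} c := by
    set w := R (ord3 b c a) with hw
    have hpos : 0 < 1 - 2 * w := by linarith
    have hM : half (ord3 a c b) (ord3 b c a) ∈ KSet f {a, b, c} c := by
      refine ⟨half_profile m2 m3, ?_⟩
      rw [show ({a, b, c} : Finset ℕ) = {b, c, a} by grind]
      exact caseIn f hS hf hbc hab.symm hac.symm (by simp)
    have hT : IsProfile {c, a, b}
        (fun r => (R r - 2 * w * half (ord3 a c b) (ord3 b c a) r) / (1 - 2 * w)) := by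
      rw [show ({c, a, b} : Finset ℕ) = {a, b, c} by grind]
      refine ⟨fun r hr => ?_, fun r => ?_, ?_⟩
      · dsimp only
        rw [hR.1 r hr, hM.1.1 r hr]; norm_num
      · apply div_nonneg _ hpos.le
        have := hR.2.1 r
        unfold half
        by_cases e2 : r = ord3 a c b
        · subst e2; simp only [n23, if_true, if_false]; linarith
        by_cases e3 : r = ord3 b c a
        · subst e3; simp only [n23.symm, if_true, if_false]; linarith
        simp only [e2, e3, if_false]; linarith
      · rw [← Finset.sum_div, Finset.sum_sub_distrib, ← Finset.mul_sum, hR.2.2, hM.1.2.2, mul_one,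
          div_self hpos.ne']
    have := topHalf f hS hP hf hac.symm hbc.symm hab hT (by
      rw [le_div_iff₀ hpos]
      simp only [half, n24.symm, n34.symm, if_false]; linarith)
    rw [show ({c, a, b} : Finset ℕ) = {a, b, c} by grind] at this
    have := KSet_mix f hP (by simp) hM this (l := 2 * w)
      (by linarith) (by linarith)
    convert this using 1
    funext r
    field_simp
    ring
  have e1 := ha.2
  have e2 := hc.2
  rw [hp, Set.mem_singleton_iff] at e1 e2
  have := congrFun (e1.trans e2.symm) a
  simp [degLottery, hac] at this

/-- There is no SCF satisfying population-consistency and composition-consistency. -/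
theorem no_scf_populationConsistent_compositionConsistent :
    ¬ ∃ f : PSCF, IsSCF f ∧ PopulationConsistent f ∧ CompositionConsistent f := by
  rintro ⟨f, hS, hP, hf⟩
  obtain ⟨x, hx, h⟩ := exists_deg f hS (A := {0, 1, 2}) (by simp)
    (cyc_profile (a := 0) (b := 1) (c := 2) (by simp) (by simp) (by simp))
  simp only [Finset.mem_insert, Finset.mem_singleton] at hx
  rcases hx with rfl | rfl | rfl
  · exact main f hS hP hf (by simp) (by simp) (by simp) h
  · rw [cyc_rot, show ({0, 1, 2} : Finset ℕ) = {1, 2, 0} by decide] at h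
    exact main f hS hP hf (by simp) (by simp) (by simp) h
  · rw [cyc_rot, cyc_rot, show ({0, 1, 2} : Finset ℕ) = {2, 0, 1} by decide] at h
    exact main f hS hP hf (by simp) (by simp) (by simp) h

end PSC
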